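/- Let α > 2 and β > 0, let φ be an analytic self-map of the open unit disk D, and let g be analytic on D. Then the operator C_φU_g, defined by (C_φU_g f)(z) = ∫₀^{φ(z)} f(ξ) g'(ξ) dξ, is bounded from Z^α to Z^β if and only if sup_{z∈D} (1−|z|²)^β |g'(φ(z))(φ'(z))²| / (1−|φ(z)|²)^{α−1} < ∞ and sup_{z∈D} (1−|z|²)^β |g''(φ(z))(φ'(z))² + g'(φ(z))φ''(z)| / (1−|φ(z)|²)^{α−2} < ∞. -/

import Mathlib

noncomputable section

/-- The open unit disk in the complex plane. -/
def uD : Set ℂ := Metric.ball 0 1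

/-- The Zygmund-type quantity `(1-|z|^2)^a * |f''(z)|`. -/
def zygS (a : ℝ) (f : ℂ → ℂ) (z : ℂ) : ℝ := (1 - ‖z‖ ^ 2) ^ a * ‖deriv (deriv f) z‖

/-- Membership in the Zygmund-type space `Z^a`. -/
def memZ (a : ℝ) (f : ℂ → ℂ) : Prop :=
  AnalyticOn ℂ f uD ∧ ∃ M : ℝ, ∀ z ∈ uD, zygS a f z ≤ M

/-- The Zygmund-type norm `‖f‖_{Z^a} = |f 0| + |f' 0| + sup_{z ∈ D} (1-|z|^2)^a |f''(z)|`. -/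
def zNorm (a : ℝ) (f : ℂ → ℂ) : ℝ := ‖f 0‖ + ‖deriv f 0‖ + sSup (zygS a f '' uD)

/-- Membership in the weighted space `H^∞_{v_b}` (for `u` analytic on `uD`). -/
def memHv (b : ℝ) (u : ℂ → ℂ) : Prop :=
  ∃ M : ℝ, ∀ z ∈ uD, (1 - ‖z‖ ^ 2) ^ b * ‖u z‖ ≤ M

/-- `T` is a bounded operator from `Z^a` to `Z^b`. -/
def boundedOp (a b : ℝ) (T : (ℂ → ℂ) → ℂ → ℂ) : Prop :=
  (∀ f, memZ a f → memZ b (T f)) ∧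
    ∃ C > 0, ∀ f, memZ a f → zNorm b (T f) ≤ C * zNorm a f

/-- `(C_φ U_g f)(z) = ∫₀^{φ(z)} f(ξ) g'(ξ) dξ`, parametrized along the segment from `0` to `φ z`. -/
def CphiUg (g φ : ℂ → ℂ) (f : ℂ → ℂ) : ℂ → ℂ :=
  fun z => ∫ t in (0:ℝ)..1, φ z * (f ((t : ℂ) * φ z) * deriv g ((t : ℂ) * φ z))


lemma uD_open : IsOpen uD := Metric.isOpen_ball

lemma mem_uD {z : ℂ} : z ∈ uD ↔ ‖z‖ < 1 := by simp [uD]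

lemma diffAt {f : ℂ → ℂ} (hf : AnalyticOn ℂ f uD) {z : ℂ} (hz : z ∈ uD) :
    HasDerivAt f (deriv f z) z :=
  (((Complex.analyticOn_iff_differentiableOn uD_open).1 hf).differentiableAt
    (uD_open.mem_nhds hz)).hasDerivAt

lemma anDeriv {f : ℂ → ℂ} (hf : AnalyticOn ℂ f uD) : AnalyticOn ℂ (deriv f) uD :=
  (Complex.analyticOn_iff_differentiableOn uD_open).2
    (((Complex.analyticOn_iff_differentiableOn uD_open).1 hf).deriv uD_open)

lemma smul_mem_uD {w : ℂ} (hw : w ∈ uD) {t : ℝ} (ht : t ∈ Set.Icc (0:ℝ) 1) :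
    (t : ℂ) * w ∈ uD := by
  rw [mem_uD] at *
  rw [norm_mul, Complex.norm_real, Real.norm_of_nonneg ht.1]
  nlinarith [ht.1, ht.2, norm_nonneg w]

lemma hasDerivAt_ray {u : ℂ → ℂ} (hu : AnalyticOn ℂ u uD) {w : ℂ} (hw : w ∈ uD) {t : ℝ}
    (ht : t ∈ Set.Icc (0:ℝ) 1) :
    HasDerivAt (fun t : ℝ => u ((t : ℂ) * w)) (w * deriv u ((t : ℂ) * w)) t := by
  have h1 : HasDerivAt (fun s : ℂ => s * w) w (t : ℂ) := by
    simpa using (hasDerivAt_id (t : ℂ)).mul_const w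
  have h2 := (diffAt hu (smul_mem_uD hw ht)).comp (t : ℂ) h1
  rw [mul_comm]
  exact h2.comp_ofReal

lemma exists_prim {f g : ℂ → ℂ} (hf : AnalyticOn ℂ f uD) (hg : AnalyticOn ℂ g uD) :
    ∃ H : ℂ → ℂ, (∀ w ∈ uD, HasDerivAt H (f w * deriv g w) w) ∧
      ∀ w ∈ uD, (∫ t in (0:ℝ)..1, w * (f ((t : ℂ) * w) * deriv g ((t : ℂ) * w))) = H w := by
  have hfg : AnalyticOn ℂ (fun w => f w * deriv g w) uD := hf.mul (anDeriv hg)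
  obtain ⟨H, H0, hH⟩ := (((Complex.analyticOn_iff_differentiableOn uD_open).1
    hfg).isExactOn_ball).with_val_at 0 0
  refine ⟨H, hH, fun w hw => ?_⟩
  have hHa : AnalyticOn ℂ H uD := (Complex.analyticOn_iff_differentiableOn uD_open).2
    fun w hw => (hH w hw).differentiableAt.differentiableWithinAt
  have key : ∀ t ∈ Set.uIcc (0:ℝ) 1, HasDerivAt (fun t : ℝ => H ((t : ℂ) * w))
      (w * (f ((t : ℂ) * w) * deriv g ((t : ℂ) * w))) t := by
    intro t ht
    rw [Set.uIcc_of_le zero_le_one] at ht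
    have := hasDerivAt_ray hHa hw ht
    rwa [(hH _ (smul_mem_uD hw ht)).deriv] at this
  rw [intervalIntegral.integral_eq_sub_of_hasDerivAt key]
  · simp [H0]
  · apply ContinuousOn.intervalIntegrable
    rw [Set.uIcc_of_le zero_le_one]
    refine continuousOn_const.mul (hfg.continuousOn.comp (t := uD) (by fun_prop) ?_)
    intro t ht
    exact smul_mem_uD hw ht

lemma T_deriv {f g φ : ℂ → ℂ} (hφ : AnalyticOn ℂ φ uD) (hφm : Set.MapsTo φ uD uD)
    (hf : AnalyticOn ℂ f uD) (hg : AnalyticOn ℂ g uD) {z : ℂ} (hz : z ∈ uD) :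
    HasDerivAt (CphiUg g φ f) (f (φ z) * deriv g (φ z) * deriv φ z) z := by
  obtain ⟨H, hH, hI⟩ := exists_prim hf hg
  have h := (hH _ (hφm hz)).comp z (diffAt hφ hz)
  refine h.congr_of_eventuallyEq ?_
  filter_upwards [uD_open.mem_nhds hz] with x hx
  exact hI _ (hφm hx)

lemma T_an {f g φ : ℂ → ℂ} (hφ : AnalyticOn ℂ φ uD) (hφm : Set.MapsTo φ uD uD)
    (hf : AnalyticOn ℂ f uD) (hg : AnalyticOn ℂ g uD) : AnalyticOn ℂ (CphiUg g φ f) uD :=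
  (Complex.analyticOn_iff_differentiableOn uD_open).2
    fun _ hz => (T_deriv hφ hφm hf hg hz).differentiableAt.differentiableWithinAt

lemma T_deriv2 {f g φ : ℂ → ℂ} (hφ : AnalyticOn ℂ φ uD) (hφm : Set.MapsTo φ uD uD)
    (hf : AnalyticOn ℂ f uD) (hg : AnalyticOn ℂ g uD) {z : ℂ} (hz : z ∈ uD) :
    deriv (deriv (CphiUg g φ f)) z = deriv f (φ z) * (deriv g (φ z) * (deriv φ z) ^ 2)
      + f (φ z) * (deriv (deriv g) (φ z) * (deriv φ z) ^ 2
        + deriv g (φ z) * deriv (deriv φ) z) := by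
  have h1 : HasDerivAt (fun z => f (φ z)) (deriv f (φ z) * deriv φ z) z :=
    (diffAt hf (hφm hz)).comp z (diffAt hφ hz)
  have h2 : HasDerivAt (fun z => deriv g (φ z)) (deriv (deriv g) (φ z) * deriv φ z) z :=
    (diffAt (anDeriv hg) (hφm hz)).comp z (diffAt hφ hz)
  have h3 := (h1.fun_mul h2).fun_mul (diffAt (anDeriv hφ) hz)
  have h4 : HasDerivAt (deriv (CphiUg g φ f)) _ z := h3.congr_of_eventuallyEq (by
    filter_upwards [uD_open.mem_nhds hz] with x hx
    exact (T_deriv hφ hφm hf hg hx).deriv)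
  rw [h4.deriv]
  ring

lemma zyg_bdd {a : ℝ} {f : ℂ → ℂ} (h : memZ a f) : BddAbove (zygS a f '' uD) := by
  obtain ⟨M, hM⟩ := h.2
  exact ⟨M, by rintro _ ⟨z, hz, rfl⟩; exact hM z hz⟩

lemma zyg_nonneg {a : ℝ} {f : ℂ → ℂ} {z : ℂ} (hz : z ∈ uD) : 0 ≤ zygS a f z := by
  rw [mem_uD] at hz
  have : 0 ≤ 1 - ‖z‖ ^ 2 := by nlinarith [norm_nonneg z]
  unfold zygS; positivity

lemma zyg_sup_nonneg {a : ℝ} {f : ℂ → ℂ} : 0 ≤ sSup (zygS a f '' uD) :=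
  Real.sSup_nonneg (by rintro _ ⟨z, hz, rfl⟩; exact zyg_nonneg hz)

lemma zyg_le_zNorm {a : ℝ} {f : ℂ → ℂ} (h : memZ a f) {z : ℂ} (hz : z ∈ uD) :
    zygS a f z ≤ zNorm a f := by
  have := le_csSup (zyg_bdd h) (Set.mem_image_of_mem _ hz)
  unfold zNorm
  linarith [norm_nonneg (f 0), norm_nonneg (deriv f 0)]

lemma zNorm_le {a : ℝ} {f : ℂ → ℂ} {A B M : ℝ} (h0 : ‖f 0‖ ≤ A) (h1 : ‖deriv f 0‖ ≤ B)
    (h : ∀ z ∈ uD, zygS a f z ≤ M) : zNorm a f ≤ A + B + M := by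
  have : sSup (zygS a f '' uD) ≤ M := by
    apply csSup_le
    · exact ⟨_, 0, by simp [mem_uD], rfl⟩
    · rintro _ ⟨z, hz, rfl⟩; exact h z hz
  unfold zNorm
  linarith

/-- Growth lemma. -/
lemma growth {u : ℂ → ℂ} (hu : AnalyticOn ℂ u uD) {s K : ℝ} (hs : 1 < s) (hK : 0 ≤ K)
    (hb : ∀ z ∈ uD, ‖deriv u z‖ ≤ K * (1 - ‖z‖) ^ (-s)) {z : ℂ} (hz : z ∈ uD) :
    ‖u z‖ ≤ ‖u 0‖ + K / (s - 1) * (1 - ‖z‖) ^ (1 - s) := by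
  have hs1 : 0 < s - 1 := by linarith
  have hz1 := mem_uD.1 hz
  have pos : ∀ t ∈ Set.Icc (0:ℝ) 1, 0 < 1 - t * ‖z‖ := fun t ht => by
    nlinarith [ht.1, ht.2, norm_nonneg z]
  have hB : ∀ t ∈ Set.Icc (0:ℝ) 1, HasDerivAt
      (fun t : ℝ => ‖u 0‖ + K / (s - 1) * (1 - t * ‖z‖) ^ (1 - s))
      (K * ‖z‖ * (1 - t * ‖z‖) ^ (-s)) t := by
    intro t ht
    have h1 : HasDerivAt (fun t : ℝ => 1 - t * ‖z‖) (-‖z‖) t := by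
      simpa using ((hasDerivAt_id t).mul_const ‖z‖).const_sub 1
    have h2 := ((h1.rpow_const (p := 1 - s) (Or.inl (pos t ht).ne')).const_mul
      (K / (s - 1))).const_add ‖u 0‖
    convert! h2 using 1
    rw [show 1 - s - 1 = -s by ring]
    field_simp
    ring
  have := image_norm_le_of_norm_deriv_right_le_deriv_boundary' (a := 0) (b := 1)
    (f := fun t : ℝ => u ((t : ℂ) * z)) (f' := fun t : ℝ => z * deriv u ((t : ℂ) * z))
    (fun t ht => (hasDerivAt_ray hu hz ht).continuousAt.continuousWithinAt)
    (fun t ht => (hasDerivAt_ray hu hz (Set.Ico_subset_Icc_self ht)).hasDerivWithinAt)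
    (B := fun t : ℝ => ‖u 0‖ + K / (s - 1) * (1 - t * ‖z‖) ^ (1 - s))
    (B' := fun t : ℝ => K * ‖z‖ * (1 - t * ‖z‖) ^ (-s))
    (by simp; positivity)
    (fun t ht => (hB t ht).continuousAt.continuousWithinAt)
    (fun t ht => (hB t (Set.Ico_subset_Icc_self ht)).hasDerivWithinAt)
    (by
      intro t ht
      have ht' := Set.Ico_subset_Icc_self ht
      have := hb _ (smul_mem_uD hz ht')
      rw [norm_mul (t : ℂ), Complex.norm_real, Real.norm_of_nonneg ht.1] at this
      rw [norm_mul]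
      calc _ ≤ ‖z‖ * (K * (1 - t * ‖z‖) ^ (-s)) := by gcongr
        _ = _ := by ring)
    (x := 1) (by simp)
  simpa using this

lemma one_le_rp {z : ℂ} (hz : z ∈ uD) {s : ℝ} (hs : 0 ≤ s) : 1 ≤ (1 - ‖z‖) ^ (-s) := by
  rw [mem_uD] at hz
  exact Real.one_le_rpow_of_pos_of_le_one_of_nonpos (by linarith) (by linarith [norm_nonneg z])
    (by linarith)

lemma growths {α : ℝ} (hα : 2 < α) {f : ℂ → ℂ} (hf : memZ α f) {z : ℂ} (hz : z ∈ uD) :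
    ‖deriv f z‖ ≤ 2 * zNorm α f * (1 - ‖z‖) ^ (-(α - 1)) ∧
    ‖f z‖ ≤ (1 + 2 / (α - 2)) * zNorm α f * (1 - ‖z‖) ^ (-(α - 2)) := by
  set N := zNorm α f with hN
  have n0 : ‖f 0‖ ≤ N := by
    rw [hN, zNorm]; linarith [zyg_sup_nonneg (a := α) (f := f), norm_nonneg (deriv f 0)]
  have n1 : ‖deriv f 0‖ ≤ N := by
    rw [hN, zNorm]; linarith [zyg_sup_nonneg (a := α) (f := f), norm_nonneg (f 0)]
  have Nn : 0 ≤ N := (norm_nonneg _).trans n0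
  have h2 : ∀ z ∈ uD, ‖deriv (deriv f) z‖ ≤ N * (1 - ‖z‖) ^ (-α) := by
    intro z hz
    have h := zyg_le_zNorm hf hz
    rw [mem_uD] at hz
    have p : 0 < 1 - ‖z‖ := by linarith
    have q : 1 - ‖z‖ ≤ 1 - ‖z‖ ^ 2 := by nlinarith [norm_nonneg z]
    rw [Real.rpow_neg p.le, ← div_eq_mul_inv, le_div_iff₀ (by positivity), mul_comm]
    refine le_trans ?_ h
    unfold zygS
    gcongr
  have h1 : ∀ z ∈ uD, ‖deriv f z‖ ≤ 2 * N * (1 - ‖z‖) ^ (-(α - 1)) := by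
    intro z hz
    have := growth (anDeriv hf.1) (by linarith) Nn h2 hz
    have o := one_le_rp hz (s := α - 1) (by linarith)
    rw [show 1 - α = -(α - 1) by ring] at this
    have : N / (α - 1) ≤ N := div_le_self Nn (by linarith)
    nlinarith
  refine ⟨h1 z hz, ?_⟩
  have := growth hf.1 (by linarith) (by positivity) h1 hz
  have o := one_le_rp hz (s := α - 2) (by linarith)
  rw [show 1 - (α - 1) = -(α - 2) by ring, show α - 1 - 1 = α - 2 by ring] at this
  calc _ ≤ _ := this
    _ ≤ N * (1 - ‖z‖) ^ (-(α - 2)) + 2 * N / (α - 2) * (1 - ‖z‖) ^ (-(α - 2)) := by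
      gcongr; nlinarith
    _ = _ := by ring

lemma rp_conv {z : ℂ} (hz : z ∈ uD) {s : ℝ} (hs : 0 ≤ s) :
    (1 - ‖z‖) ^ (-s) ≤ 2 ^ s * ((1 - ‖z‖ ^ 2) ^ s)⁻¹ := by
  rw [mem_uD] at hz
  have p : 0 < 1 - ‖z‖ := by linarith
  have q : 0 < 1 - ‖z‖ ^ 2 := by nlinarith [norm_nonneg z]
  rw [Real.rpow_neg p.le, ← div_eq_mul_inv, le_div_iff₀ (by positivity), mul_comm,
    ← div_eq_mul_inv, div_le_iff₀ (by positivity), ← Real.mul_rpow (by norm_num) p.le]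
  gcongr
  nlinarith [norm_nonneg z]

lemma suff {α β : ℝ} (hα : 2 < α) {φ g : ℂ → ℂ} (hφ : AnalyticOn ℂ φ uD)
    (hφm : Set.MapsTo φ uD uD) (hg : AnalyticOn ℂ g uD) {M₁ M₂ : ℝ}
    (h1 : ∀ z ∈ uD, (1 - ‖z‖ ^ 2) ^ β * ‖deriv g (φ z) * (deriv φ z) ^ 2‖ /
      (1 - ‖φ z‖ ^ 2) ^ (α - 1) ≤ M₁)
    (h2 : ∀ z ∈ uD, (1 - ‖z‖ ^ 2) ^ β * ‖deriv (deriv g) (φ z) * (deriv φ z) ^ 2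
      + deriv g (φ z) * deriv (deriv φ) z‖ / (1 - ‖φ z‖ ^ 2) ^ (α - 2) ≤ M₂) :
    boundedOp α β (CphiUg g φ) := by
  set K := 1 + 2 / (α - 2) with hK
  have hα2 : 0 < α - 2 := by linarith
  have Kpos : 0 < K := by positivity
  have z0 : (0:ℂ) ∈ uD := by simp [mem_uD]
  have nn : ∀ f, 0 ≤ zNorm α f := fun f => by
    unfold zNorm
    have := zyg_sup_nonneg (a := α) (f := f)
    positivity
  have main : ∀ f, memZ α f → ∀ z ∈ uD, zygS β (CphiUg g φ f) z ≤
      (2 * 2 ^ (α - 1) * M₁ + K * 2 ^ (α - 2) * M₂) * zNorm α f := by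
    intro f hf z hz
    have hN := nn f
    obtain ⟨g1, g2⟩ := growths hα hf (hφm hz)
    have c1 := rp_conv (hφm hz) (s := α - 1) (by linarith)
    have c2 := rp_conv (hφm hz) (s := α - 2) (by linarith)
    have d1 := h1 z hz
    have d2 := h2 z hz
    have q : 0 ≤ 1 - ‖z‖ ^ 2 := by
      rw [mem_uD] at hz; nlinarith [norm_nonneg z]
    have q' : 0 ≤ 1 - ‖φ z‖ ^ 2 := by
      have := mem_uD.1 (hφm hz); nlinarith [norm_nonneg (φ z)]
    unfold zygS
    rw [T_deriv2 hφ hφm hf.1 hg hz]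
    set P := deriv g (φ z) * (deriv φ z) ^ 2
    set Q := deriv (deriv g) (φ z) * (deriv φ z) ^ 2 + deriv g (φ z) * deriv (deriv φ) z
    set N := zNorm α f
    set W := (1 - ‖z‖ ^ 2) ^ β
    have hW : 0 ≤ W := by positivity
    calc W * ‖deriv f (φ z) * P + f (φ z) * Q‖
        ≤ W * (‖deriv f (φ z)‖ * ‖P‖ + ‖f (φ z)‖ * ‖Q‖) := by
          gcongr
          refine (norm_add_le _ _).trans ?_
          rw [norm_mul (deriv f (φ z)) P, norm_mul (f (φ z)) Q]
      _ ≤ W * ((2 * N * (2 ^ (α - 1) * ((1 - ‖φ z‖ ^ 2) ^ (α - 1))⁻¹)) * ‖P‖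
          + (K * N * (2 ^ (α - 2) * ((1 - ‖φ z‖ ^ 2) ^ (α - 2))⁻¹)) * ‖Q‖) := by
          gcongr
          · exact g1.trans (by gcongr)
          · exact g2.trans (by gcongr)
      _ = (2 * 2 ^ (α - 1) * (W * ‖P‖ / (1 - ‖φ z‖ ^ 2) ^ (α - 1)) +
          K * 2 ^ (α - 2) * (W * ‖Q‖ / (1 - ‖φ z‖ ^ 2) ^ (α - 2))) * N := by
          simp only [div_eq_mul_inv]; ring
      _ ≤ _ := by gcongr
  refine ⟨fun f hf => ⟨T_an hφ hφm hf.1 hg, _, main f hf⟩, ?_⟩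
  -- a bound for the derivative of g on the segment
  obtain ⟨L, hL⟩ : ∃ L, ∀ t ∈ Set.Icc (0:ℝ) 1, ‖deriv g ((t : ℂ) * φ 0)‖ ≤ L := by
    apply isCompact_Icc.exists_bound_of_continuousOn
    refine (anDeriv hg).continuousOn.comp (t := uD) (by fun_prop) ?_
    intro t ht
    exact smul_mem_uD (hφm z0) ht
  have L0 : 0 ≤ L := (norm_nonneg _).trans (hL 0 (by simp))
  have w1 := mem_uD.1 (hφm z0)
  have wp : 0 < 1 - ‖φ 0‖ := by linarith
  set R := (1 - ‖φ 0‖) ^ (-(α - 2)) with hR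
  have Rpos : 0 < R := by positivity
  have fb : ∀ f, memZ α f → ∀ t ∈ Set.Icc (0:ℝ) 1, ‖f ((t : ℂ) * φ 0)‖ ≤ K * zNorm α f * R := by
    intro f hf t ht
    have hN := nn f
    refine (growths hα hf (smul_mem_uD (hφm z0) ht)).2.trans ?_
    gcongr
    apply Real.rpow_le_rpow_of_nonpos wp _ (by linarith)
    rw [norm_mul, Complex.norm_real, Real.norm_of_nonneg ht.1]
    nlinarith [ht.1, ht.2, norm_nonneg (φ 0)]
  set A := K * R * L
  set B := K * R * L * ‖deriv φ 0‖
  set M := 2 * 2 ^ (α - 1) * M₁ + K * 2 ^ (α - 2) * M₂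
  refine ⟨|A + B + M| + 1, by positivity, fun f hf => ?_⟩
  have hN := nn f
  have e0 : ‖CphiUg g φ f 0‖ ≤ A * zNorm α f := by
    have := intervalIntegral.norm_integral_le_of_norm_le_const (a := (0:ℝ)) (b := 1)
      (f := fun t : ℝ => φ 0 * (f ((t : ℂ) * φ 0) * deriv g ((t : ℂ) * φ 0)))
      (C := A * zNorm α f) (by
        intro t ht
        rw [Set.uIoc_of_le zero_le_one] at ht
        have ht' := Set.Ioc_subset_Icc_self ht
        rw [norm_mul, norm_mul]
        calc _ ≤ 1 * ((K * zNorm α f * R) * L) := by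
              gcongr
              · exact fb f hf t ht'
              · exact hL t ht'
          _ = _ := by ring)
    rw [sub_zero, abs_one, mul_one] at this
    exact this
  have e1 : ‖deriv (CphiUg g φ f) 0‖ ≤ B * zNorm α f := by
    rw [(T_deriv hφ hφm hf.1 hg z0).deriv, norm_mul, norm_mul]
    have a1 := fb f hf 1 (by simp)
    have a2 := hL 1 (by simp)
    simp only [Complex.ofReal_one, one_mul] at a1 a2
    calc _ ≤ (K * zNorm α f * R) * L * ‖deriv φ 0‖ := by gcongr
      _ = _ := by ring
  calc _ ≤ _ := zNorm_le e0 e1 (main f hf)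
    _ = (A + B + M) * zNorm α f := by ring
    _ ≤ _ := by
      refine mul_le_mul_of_nonneg_right ?_ hN
      linarith [le_abs_self (A + B + M)]

/-- The basic kernel. -/
def ker (a : ℂ) (s : ℝ) (z : ℂ) : ℂ := (1 - (starRingEnd ℂ) a * z) ^ (-(s : ℂ))

lemma ker_bd {a z : ℂ} (ha : a ∈ uD) (hz : z ∈ uD) :
    0 < (1 - (starRingEnd ℂ) a * z).re ∧ 0 < ‖1 - (starRingEnd ℂ) a * z‖ ∧
    1 - ‖z‖ ^ 2 ≤ 2 * ‖1 - (starRingEnd ℂ) a * z‖ ∧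
    1 - ‖a‖ ^ 2 ≤ 2 * ‖1 - (starRingEnd ℂ) a * z‖ ∧
    ‖z - a‖ ≤ ‖1 - (starRingEnd ℂ) a * z‖ := by
  rw [mem_uD] at ha hz
  have n : ‖(starRingEnd ℂ) a * z‖ = ‖a‖ * ‖z‖ := by simp
  have h1 : 1 - ‖a‖ * ‖z‖ ≤ ‖1 - (starRingEnd ℂ) a * z‖ := by
    have := norm_sub_norm_le (1 : ℂ) ((starRingEnd ℂ) a * z)
    rwa [n, norm_one] at this
  have ha0 := norm_nonneg a
  have hz0 := norm_nonneg z
  have h2 := Complex.re_le_norm ((starRingEnd ℂ) a * z)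
  rw [n] at h2
  refine ⟨?_, by nlinarith, by nlinarith, by nlinarith, ?_⟩
  · rw [Complex.sub_re, Complex.one_re]; nlinarith
  · refine (sq_le_sq₀ (norm_nonneg _) (norm_nonneg _)).1 ?_
    have e : ‖1 - (starRingEnd ℂ) a * z‖ ^ 2 - ‖z - a‖ ^ 2 = (1 - ‖a‖ ^ 2) * (1 - ‖z‖ ^ 2) := by
      simp only [← Complex.normSq_eq_norm_sq, Complex.normSq_apply, Complex.sub_re, Complex.sub_im,
        Complex.mul_re, Complex.mul_im, Complex.conj_re, Complex.conj_im, Complex.one_re,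
        Complex.one_im]
      ring
    have : 0 ≤ (1 - ‖a‖ ^ 2) * (1 - ‖z‖ ^ 2) := mul_nonneg (by nlinarith) (by nlinarith)
    linarith

lemma ker_deriv {a z : ℂ} (ha : a ∈ uD) (hz : z ∈ uD) (s : ℝ) :
    HasDerivAt (ker a s) (s * (starRingEnd ℂ) a * ker a (s + 1) z) z := by
  have h1 : HasDerivAt (fun z : ℂ => 1 - (starRingEnd ℂ) a * z) (-(starRingEnd ℂ) a) z := by
    simpa using ((hasDerivAt_id z).const_mul ((starRingEnd ℂ) a)).const_sub 1
  have h2 := h1.cpow_const (c := -(s : ℂ)) (Or.inl (ker_bd ha hz).1)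
  convert! h2 using 1
  unfold ker
  push_cast
  rw [show -((s : ℂ) + 1) = -(s : ℂ) - 1 by ring]
  ring

lemma ker_norm (a z : ℂ) (s : ℝ) : ‖ker a s z‖ = ‖1 - (starRingEnd ℂ) a * z‖ ^ (-s) := by
  unfold ker
  rw [← Complex.ofReal_neg, Complex.norm_cpow_real]

lemma ker_self {a : ℂ} (ha : a ∈ uD) (s : ℝ) : ker a s a = (((1 - ‖a‖ ^ 2) ^ (-s) : ℝ) : ℂ) := by
  rw [mem_uD] at ha
  have : 0 ≤ 1 - ‖a‖ ^ 2 := by nlinarith [norm_nonneg a]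
  unfold ker
  rw [← Complex.normSq_eq_conj_mul_self, Complex.normSq_eq_norm_sq, Complex.ofReal_cpow this]
  push_cast
  rfl

lemma ker_zero (a : ℂ) (s : ℝ) : ker a s 0 = 1 := by simp [ker]

/-- Weighted estimate. -/
lemma ker_est {a z : ℂ} (ha : a ∈ uD) (hz : z ∈ uD) {α : ℝ} (hα : 0 < α) :
    (1 - ‖z‖ ^ 2) ^ α * ((1 - ‖a‖ ^ 2) * ‖ker a (α + 1) z‖) ≤ 2 ^ (α + 1) := by
  obtain ⟨-, hp, h1, h2, -⟩ := ker_bd ha hz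
  rw [mem_uD] at ha hz
  have q : 0 ≤ 1 - ‖a‖ ^ 2 := by nlinarith [norm_nonneg a]
  have q' : 0 ≤ 1 - ‖z‖ ^ 2 := by nlinarith [norm_nonneg z]
  rw [ker_norm]
  set d := ‖1 - (starRingEnd ℂ) a * z‖
  calc _ ≤ (2 * d) ^ α * ((2 * d) * d ^ (-(α + 1))) := by gcongr
    _ = 2 ^ (α + 1) * (d ^ (α + 1) * d ^ (-(α + 1))) := by
      rw [Real.mul_rpow (by norm_num) hp.le, Real.rpow_add_one (by norm_num),
        Real.rpow_add_one hp.ne']; ring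
    _ = _ := by rw [← Real.rpow_add hp]; simp

lemma test_k {α : ℝ} (hα : 2 < α) : ∃ C, ∀ a ∈ uD, ∃ f, memZ α f ∧ zNorm α f ≤ C ∧
    f a = (((1 - ‖a‖ ^ 2) ^ (-(α - 2)) : ℝ) : ℂ) ∧
    deriv f a = (α - 1) * (starRingEnd ℂ) a * (((1 - ‖a‖ ^ 2) ^ (-(α - 1)) : ℝ) : ℂ) := by
  refine ⟨1 + (α - 1) + α * (α - 1) * 2 ^ (α + 1), fun a ha => ?_⟩
  set c : ℂ := ((1 - ‖a‖ ^ 2 : ℝ) : ℂ) with hc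
  have ha' := mem_uD.1 ha
  have q : 0 < 1 - ‖a‖ ^ 2 := by nlinarith [norm_nonneg a]
  have q1 : 1 - ‖a‖ ^ 2 ≤ 1 := by nlinarith [norm_nonneg a]
  have cn : ‖c‖ = 1 - ‖a‖ ^ 2 := by rw [hc, Complex.norm_real, Real.norm_of_nonneg q.le]
  have an : ‖(starRingEnd ℂ) a‖ ≤ 1 := by simpa using ha'.le
  have z0 : (0:ℂ) ∈ uD := by simp [mem_uD]
  let f : ℂ → ℂ := fun z => c * ker a (α - 1) z
  have d1 : ∀ z ∈ uD, HasDerivAt f (c * ((α - 1) * (starRingEnd ℂ) a * ker a α z)) z := by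
    intro z hz
    have := (ker_deriv ha hz (α - 1)).const_mul c
    convert! this using 1
    rw [sub_add_cancel]; push_cast; ring
  have d2 : ∀ z ∈ uD, deriv (deriv f) z =
      c * ((α - 1) * (starRingEnd ℂ) a * (α * (starRingEnd ℂ) a * ker a (α + 1) z)) := by
    intro z hz
    have := ((ker_deriv ha hz α).const_mul (((α:ℂ) - 1) * (starRingEnd ℂ) a)).const_mul c
    exact (this.congr_of_eventuallyEq (by
      filter_upwards [uD_open.mem_nhds hz] with x hx
      exact (d1 x hx).deriv)).deriv
  have n1 : ‖(α:ℂ) - 1‖ = α - 1 := by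
    rw [← Complex.ofReal_one, ← Complex.ofReal_sub, Complex.norm_real,
      Real.norm_of_nonneg (by linarith)]
  have n2 : ‖(α:ℂ)‖ = α := by
    rw [Complex.norm_real, Real.norm_of_nonneg (by linarith)]
  have hα1 : 0 < α - 1 := by linarith
  have hα0 : 0 < α := by linarith
  have bd : ∀ z ∈ uD, zygS α f z ≤ α * (α - 1) * 2 ^ (α + 1) := by
    intro z hz
    have e := ker_est ha hz hα0
    unfold zygS
    rw [d2 z hz]
    have q' : 0 ≤ 1 - ‖z‖ ^ 2 := by
      rw [mem_uD] at hz; nlinarith [norm_nonneg z]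
    simp only [norm_mul, n1, n2, cn]
    calc _ ≤ (1 - ‖z‖ ^ 2) ^ α * ((1 - ‖a‖ ^ 2) *
          ((α - 1) * 1 * (α * 1 * ‖ker a (α + 1) z‖))) := by gcongr
      _ = α * (α - 1) * ((1 - ‖z‖ ^ 2) ^ α * ((1 - ‖a‖ ^ 2) * ‖ker a (α + 1) z‖)) := by ring
      _ ≤ _ := by gcongr
  refine ⟨f, ⟨(Complex.analyticOn_iff_differentiableOn uD_open).2
    fun z hz => (d1 z hz).differentiableAt.differentiableWithinAt, _, bd⟩,
    zNorm_le ?_ ?_ bd, ?_, ?_⟩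
  · simp only [f, ker_zero, mul_one, cn, q1]
  · rw [(d1 0 z0).deriv, ker_zero]
    simp only [norm_mul, n1, cn, norm_one]
    calc _ ≤ 1 * ((α - 1) * 1 * 1) := by gcongr
      _ = _ := by ring
  · simp only [f, ker_self ha, hc]
    rw [← Complex.ofReal_mul]
    congr 1
    rw [show -(α - 2) = -(α - 1) + 1 by ring, Real.rpow_add_one q.ne', mul_comm]
  · rw [(d1 a ha).deriv, ker_self ha, hc, show -(α - 1) = -α + 1 by ring, Real.rpow_add_one q.ne']
    push_cast; ring

lemma test_h {α : ℝ} (hα : 2 < α) : ∃ C, ∀ a ∈ uD, ∃ f, memZ α f ∧ zNorm α f ≤ C ∧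
    f a = 0 ∧ deriv f a = (((1 - ‖a‖ ^ 2) ^ (-(α - 1)) : ℝ) : ℂ) := by
  refine ⟨1 + (1 + α) + (2 * α + α * (α + 1)) * 2 ^ (α + 1), fun a ha => ?_⟩
  set c : ℂ := ((1 - ‖a‖ ^ 2 : ℝ) : ℂ) with hc
  have ha' := mem_uD.1 ha
  have q : 0 < 1 - ‖a‖ ^ 2 := by nlinarith [norm_nonneg a]
  have q1 : 1 - ‖a‖ ^ 2 ≤ 1 := by nlinarith [norm_nonneg a]
  have cn : ‖c‖ = 1 - ‖a‖ ^ 2 := by rw [hc, Complex.norm_real, Real.norm_of_nonneg q.le]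
  have an : ‖(starRingEnd ℂ) a‖ ≤ 1 := by simpa using ha'.le
  have z0 : (0:ℂ) ∈ uD := by simp [mem_uD]
  let f : ℂ → ℂ := fun z => c * ((z - a) * ker a α z)
  have ds : ∀ z : ℂ, HasDerivAt (fun z => z - a) 1 z := fun z => (hasDerivAt_id z).sub_const a
  have d1 : ∀ z ∈ uD, HasDerivAt f (c * (ker a α z +
      (z - a) * (α * (starRingEnd ℂ) a * ker a (α + 1) z))) z := by
    intro z hz
    have := ((ds z).fun_mul (ker_deriv ha hz α)).const_mul c
    convert! this using 1
    ring
  have d2 : ∀ z ∈ uD, deriv (deriv f) z =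
      c * (2 * (α * (starRingEnd ℂ) a * ker a (α + 1) z) +
        (z - a) * (α * (starRingEnd ℂ) a * ((α + 1) * (starRingEnd ℂ) a * ker a (α + 2) z))) := by
    intro z hz
    have := ((ker_deriv ha hz α).fun_add ((ds z).fun_mul ((ker_deriv ha hz (α + 1)).const_mul
      ((α:ℂ) * (starRingEnd ℂ) a)))).const_mul c
    rw [(this.congr_of_eventuallyEq (by
      filter_upwards [uD_open.mem_nhds hz] with x hx
      exact (d1 x hx).deriv)).deriv, show α + 1 + 1 = α + 2 by ring]
    push_cast
    ring
  have n1 : ‖(α:ℂ) + 1‖ = α + 1 := by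
    rw [← Complex.ofReal_one, ← Complex.ofReal_add, Complex.norm_real,
      Real.norm_of_nonneg (by linarith)]
  have n2 : ‖(α:ℂ)‖ = α := by
    rw [Complex.norm_real, Real.norm_of_nonneg (by linarith)]
  have hα0 : 0 < α := by linarith
  have bd : ∀ z ∈ uD, zygS α f z ≤ (2 * α + α * (α + 1)) * 2 ^ (α + 1) := by
    intro z hz
    have e := ker_est ha hz hα0
    obtain ⟨-, hp, -, -, h3⟩ := ker_bd ha hz
    have e2 : ‖z - a‖ * ‖ker a (α + 2) z‖ ≤ ‖ker a (α + 1) z‖ := by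
      rw [ker_norm, ker_norm, show -(α + 1) = -(α + 2) + 1 by ring, Real.rpow_add_one hp.ne',
        mul_comm]
      gcongr
    unfold zygS
    rw [d2 z hz]
    have q' : 0 ≤ 1 - ‖z‖ ^ 2 := by
      rw [mem_uD] at hz; nlinarith [norm_nonneg z]
    rw [norm_mul, cn]
    calc _ ≤ (1 - ‖z‖ ^ 2) ^ α * ((1 - ‖a‖ ^ 2) *
          (2 * (α * 1 * ‖ker a (α + 1) z‖) +
            ‖z - a‖ * (α * 1 * ((α + 1) * 1 * ‖ker a (α + 2) z‖)))) := by
          gcongr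
          refine (norm_add_le _ _).trans ?_
          simp only [norm_mul, n1, n2, Complex.norm_ofNat]
          gcongr
      _ = (1 - ‖z‖ ^ 2) ^ α * ((1 - ‖a‖ ^ 2) * (2 * α * ‖ker a (α + 1) z‖ +
            α * (α + 1) * (‖z - a‖ * ‖ker a (α + 2) z‖))) := by ring
      _ ≤ (1 - ‖z‖ ^ 2) ^ α * ((1 - ‖a‖ ^ 2) * (2 * α * ‖ker a (α + 1) z‖ +
            α * (α + 1) * ‖ker a (α + 1) z‖)) := by gcongr
      _ = (2 * α + α * (α + 1)) *
            ((1 - ‖z‖ ^ 2) ^ α * ((1 - ‖a‖ ^ 2) * ‖ker a (α + 1) z‖)) := by ring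
      _ ≤ _ := by gcongr
  refine ⟨f, ⟨(Complex.analyticOn_iff_differentiableOn uD_open).2
    fun z hz => (d1 z hz).differentiableAt.differentiableWithinAt, _, bd⟩,
    zNorm_le ?_ ?_ bd, ?_, ?_⟩
  · simp only [f, ker_zero, mul_one, norm_mul, cn, zero_sub, norm_neg]
    nlinarith [norm_nonneg a]
  · rw [(d1 0 z0).deriv, ker_zero, ker_zero, norm_mul, cn]
    calc _ ≤ 1 * (1 + 1 * (α * 1 * 1)) := by
          gcongr
          refine (norm_add_le _ _).trans ?_
          simp only [norm_mul, n2, norm_one, zero_sub, norm_neg]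
          gcongr
      _ = _ := by ring
  · simp [f]
  · rw [(d1 a ha).deriv, ker_self ha, hc, show -(α - 1) = -α + 1 by ring, Real.rpow_add_one q.ne']
    push_cast; ring

lemma nec {α β : ℝ} (hα : 2 < α) {φ g : ℂ → ℂ} (hφ : AnalyticOn ℂ φ uD)
    (hφm : Set.MapsTo φ uD uD) (hg : AnalyticOn ℂ g uD) (h : boundedOp α β (CphiUg g φ)) :
    (∃ M : ℝ, ∀ z ∈ uD, (1 - ‖z‖ ^ 2) ^ β * ‖deriv g (φ z) * (deriv φ z) ^ 2‖ /
      (1 - ‖φ z‖ ^ 2) ^ (α - 1) ≤ M) ∧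
    (∃ M : ℝ, ∀ z ∈ uD, (1 - ‖z‖ ^ 2) ^ β * ‖deriv (deriv g) (φ z) * (deriv φ z) ^ 2
      + deriv g (φ z) * deriv (deriv φ) z‖ / (1 - ‖φ z‖ ^ 2) ^ (α - 2) ≤ M) := by
  obtain ⟨hm, C, Cpos, hC⟩ := h
  have key : ∀ f, memZ α f → ∀ z ∈ uD, (1 - ‖z‖ ^ 2) ^ β *
      ‖deriv f (φ z) * (deriv g (φ z) * (deriv φ z) ^ 2)
      + f (φ z) * (deriv (deriv g) (φ z) * (deriv φ z) ^ 2
        + deriv g (φ z) * deriv (deriv φ) z)‖ ≤ C * zNorm α f := by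
    intro f hf z hz
    have := (zyg_le_zNorm (hm f hf) hz).trans (hC f hf)
    rwa [zygS, T_deriv2 hφ hφm hf.1 hg hz] at this
  have qq : ∀ z ∈ uD, 0 < 1 - ‖φ z‖ ^ 2 := fun z hz => by
    have := mem_uD.1 (hφm hz); nlinarith [norm_nonneg (φ z)]
  have qz : ∀ z ∈ uD, 0 ≤ 1 - ‖z‖ ^ 2 := fun z hz => by
    have := mem_uD.1 hz; nlinarith [norm_nonneg z]
  obtain ⟨C1, h1⟩ := test_h hα
  obtain ⟨C2, h2⟩ := test_k hα
  have first : ∀ z ∈ uD, (1 - ‖z‖ ^ 2) ^ β * ‖deriv g (φ z) * (deriv φ z) ^ 2‖ /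
      (1 - ‖φ z‖ ^ 2) ^ (α - 1) ≤ C * C1 := by
    intro z hz
    obtain ⟨f, hf, hN, f0, f1⟩ := h1 _ (hφm hz)
    have k := key f hf z hz
    have p := qq z hz
    rw [f0, f1, zero_mul, add_zero, norm_mul, Complex.norm_real,
      Real.norm_of_nonneg (by positivity), Real.rpow_neg p.le] at k
    calc _ = _ := by rw [div_eq_mul_inv]; ring
      _ ≤ _ := k
      _ ≤ _ := by gcongr
  refine ⟨⟨_, first⟩, C * C2 + (α - 1) * (C * C1), fun z hz => ?_⟩
  obtain ⟨f, hf, hN, f0, f1⟩ := h2 _ (hφm hz)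
  have k := key f hf z hz
  have p := qq z hz
  have pz := qz z hz
  have fi := first z hz
  rw [f0, f1] at k
  set P := deriv g (φ z) * (deriv φ z) ^ 2
  set Q := deriv (deriv g) (φ z) * (deriv φ z) ^ 2 + deriv g (φ z) * deriv (deriv φ) z
  set W := (1 - ‖z‖ ^ 2) ^ β
  have hW : 0 ≤ W := by positivity
  set r1 := (1 - ‖φ z‖ ^ 2) ^ (-(α - 1)) with hr1
  set r2 := (1 - ‖φ z‖ ^ 2) ^ (-(α - 2)) with hr2
  have r1p : 0 < r1 := by positivity
  have r2p : 0 < r2 := by positivity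
  rw [div_eq_mul_inv, ← Real.rpow_neg p.le] at fi ⊢
  have n1 : ‖(α:ℂ) - 1‖ = α - 1 := by
    rw [← Complex.ofReal_one, ← Complex.ofReal_sub, Complex.norm_real,
      Real.norm_of_nonneg (by linarith)]
  have hα1 : 0 < α - 1 := by linarith
  set X : ℂ := (α - 1) * (starRingEnd ℂ) (φ z) * (r1 : ℂ) * P
  have hX : ‖X‖ ≤ (α - 1) * 1 * r1 * ‖P‖ := by
    simp only [X, norm_mul, n1, Complex.norm_real, Real.norm_of_nonneg r1p.le]
    gcongr
    simpa using (mem_uD.1 (hφm hz)).le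
  have tri : ‖(r2 : ℂ) * Q‖ ≤ ‖X + r2 * Q‖ + ‖X‖ := by
    have := norm_sub_le (X + r2 * Q) X
    rwa [add_sub_cancel_left] at this
  rw [norm_mul, Complex.norm_real, Real.norm_of_nonneg r2p.le] at tri
  calc W * ‖Q‖ * r2 = W * (r2 * ‖Q‖) := by ring
    _ ≤ W * (‖X + r2 * Q‖ + (α - 1) * 1 * r1 * ‖P‖) := by gcongr; linarith
    _ = W * ‖X + r2 * Q‖ + (α - 1) * (W * ‖P‖ * r1) := by ring
    _ ≤ C * C2 + (α - 1) * (C * C1) := by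
      refine add_le_add (k.trans (by gcongr)) (by gcongr)

theorem stmt_10 (α β : ℝ) (hα : 2 < α) (hβ : 0 < β)
    (φ g : ℂ → ℂ) (hφ : AnalyticOn ℂ φ uD) (hφm : Set.MapsTo φ uD uD)
    (hg : AnalyticOn ℂ g uD) :
    boundedOp α β (CphiUg g φ) ↔
      ((∃ M : ℝ, ∀ z ∈ uD, (1 - ‖z‖ ^ 2) ^ β * ‖deriv g (φ z) * (deriv φ z) ^ 2‖ / (1 - ‖φ z‖ ^ 2) ^ (α - 1) ≤ M) ∧ (∃ M : ℝ, ∀ z ∈ uD, (1 - ‖z‖ ^ 2) ^ β * ‖deriv (deriv g) (φ z) * (deriv φ z) ^ 2 + deriv g (φ z) * deriv (deriv φ) z‖ / (1 - ‖φ z‖ ^ 2) ^ (α - 2) ≤ M)) := by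
  constructor
  · exact nec hα hφ hφm hg
  · rintro ⟨⟨M₁, h1⟩, M₂, h2⟩
    exact suff hα hφ hφm hg h1 h2
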